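/- arXiv:2307.13684 — 2 statements merged into one kernel-verified Lean document; each statement's English description precedes it below -/
import Mathlib

section
/- Let G be a finite graph and let (T,χ) be a tree decomposition of G. Then there exists a structured tree decomposition (T',χ') of G (i.e., one in which every bag is a potential maximal clique of G) such that for every node v' of T' there exists a node v of T with χ'(v') ⊆ χ(v). -/
open Set

/-- `f` enumerates an induced path on `n` vertices in `G`. -/
def IsPathEmb {α : Type} (G : SimpleGraph α) (n : ℕ) (f : Fin n → α) : Prop :=
  Function.Injective f ∧
    ∀ i j : Fin n, G.Adj (f i) (f j) ↔ (i.val = j.val + 1 ∨ j.val = i.val + 1)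

/-- `f` enumerates an induced path from `a` to `b`. -/
def IsPathFromTo {α : Type} (G : SimpleGraph α) (n : ℕ) (f : Fin n → α) (a b : α) : Prop :=
  IsPathEmb G n f ∧ ∃ h : 1 ≤ n, f ⟨0, h⟩ = a ∧ f ⟨n - 1, by omega⟩ = b

/-- The interior (internal vertices) of the path enumerated by `f`. -/
def pathInterior {α : Type} (n : ℕ) (f : Fin n → α) : Set α :=
  {v | ∃ j : Fin n, 0 < j.val ∧ j.val < n - 1 ∧ f j = v}

/-- `k` pairwise internally vertex-disjoint induced paths from `a` to `b` in `G`. -/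
def KDisjointPaths {α : Type} (G : SimpleGraph α) (k : ℕ) (a b : α) : Prop :=
  ∃ (n : Fin k → ℕ) (f : ∀ i, Fin (n i) → α),
    (∀ i, IsPathFromTo G (n i) (f i) a b) ∧
    (∀ i j, i ≠ j → Disjoint (pathInterior (n i) (f i)) (pathInterior (n j) (f j)))

/-- `f` enumerates an induced cycle on `n` vertices. -/
def IsHoleEmb {α : Type} (G : SimpleGraph α) (n : ℕ) (f : ZMod n → α) : Prop :=
  Function.Injective f ∧ ∀ i j : ZMod n, G.Adj (f i) (f j) ↔ (i = j + 1 ∨ j = i + 1)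

/-- `H` is the vertex set of a hole of `G` (an induced cycle with at least 4 vertices). -/
def IsHole {α : Type} (G : SimpleGraph α) (H : Set α) : Prop :=
  ∃ (n : ℕ) (f : ZMod n → α), 4 ≤ n ∧ IsHoleEmb G n f ∧ Set.range f = H

/-- `G` has no even hole. -/
def EvenHoleFree {α : Type} (G : SimpleGraph α) : Prop :=
  ∀ H : Set α, IsHole G H → ¬ Even H.ncard

def Anticomplete {α : Type} (G : SimpleGraph α) (A B : Set α) : Prop :=
  ∀ a ∈ A, ∀ b ∈ B, ¬ G.Adj a b

/-- `X` is a stable (independent) set of `G`. -/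
def StableSet {α : Type} (G : SimpleGraph α) (X : Set α) : Prop :=
  ∀ a ∈ X, ∀ b ∈ X, a ≠ b → ¬ G.Adj a b

/-- The open neighborhood of the set `A`. -/
def setNbhd {α : Type} (G : SimpleGraph α) (A : Set α) : Set α :=
  {v | v ∉ A ∧ ∃ a ∈ A, G.Adj v a}

/-- The set `A` induces a connected (nonempty) subgraph of `G`. -/
def ConnSet {α : Type} (G : SimpleGraph α) (A : Set α) : Prop :=
  (G.induce A).Connected

/-- `D` is a connected component of the subgraph of `G` induced by `S`. -/
def IsCompOf {α : Type} (G : SimpleGraph α) (S D : Set α) : Prop :=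
  D ⊆ S ∧ ConnSet G D ∧ ∀ D', D ⊆ D' → D' ⊆ S → ConnSet G D' → D' = D

/-- `G` contains an (induced) theta. -/
def HasTheta {α : Type} (G : SimpleGraph α) : Prop :=
  ∃ (a b : α) (n : Fin 3 → ℕ) (f : ∀ i, Fin (n i) → α),
    a ≠ b ∧ ¬ G.Adj a b ∧ (∀ i, 3 ≤ n i) ∧
    (∀ i, IsPathFromTo G (n i) (f i) a b) ∧
    (∀ i j : Fin 3, i ≠ j → ∀ (u : Fin (n i)) (v : Fin (n j)),
      0 < u.val → u.val < n i - 1 → 0 < v.val → v.val < n j - 1 →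
      f i u ≠ f j v ∧ ¬ G.Adj (f i u) (f j v))

/-- `G` contains an (induced) prism. -/
def HasPrism {α : Type} (G : SimpleGraph α) : Prop :=
  ∃ (n : Fin 3 → ℕ) (f : ∀ i, Fin (n i) → α),
    (∀ i, 2 ≤ n i) ∧ (∀ i, IsPathEmb G (n i) (f i)) ∧
    (∀ i j : Fin 3, i ≠ j → ∀ u v, f i u ≠ f j v) ∧
    (∀ i j : Fin 3, i ≠ j → ∀ (u : Fin (n i)) (v : Fin (n j)),
      G.Adj (f i u) (f j v) ↔
        ((u.val = 0 ∧ v.val = 0) ∨ (u.val = n i - 1 ∧ v.val = n j - 1)))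

/-- The neighbors of `x` in the hole `H`. -/
def holeNbrs {α : Type} (G : SimpleGraph α) (H : Set α) (x : α) : Set α :=
  {v ∈ H | G.Adj x v}

def IsWheel {α : Type} (G : SimpleGraph α) (H : Set α) (x : α) : Prop :=
  IsHole G H ∧ x ∉ H ∧ 3 ≤ (holeNbrs G H x).ncard

def IsTwinWheel {α : Type} (G : SimpleGraph α) (H : Set α) (x : α) : Prop :=
  IsWheel G H x ∧ ∃ p q r : α, p ≠ q ∧ q ≠ r ∧ p ≠ r ∧
    holeNbrs G H x = {p, q, r} ∧ G.Adj p q ∧ G.Adj q r ∧ ¬ G.Adj p r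

def IsShortPyramid {α : Type} (G : SimpleGraph α) (H : Set α) (x : α) : Prop :=
  IsWheel G H x ∧ ∃ p q r : α, p ≠ q ∧ q ≠ r ∧ p ≠ r ∧
    holeNbrs G H x = {p, q, r} ∧ G.Adj p q ∧ ¬ G.Adj q r ∧ ¬ G.Adj p r

def IsProperWheel {α : Type} (G : SimpleGraph α) (H : Set α) (x : α) : Prop :=
  IsWheel G H x ∧ ¬ IsTwinWheel G H x ∧ ¬ IsShortPyramid G H x

/-- `x` is a hub of the induced subgraph `G[W]`. -/
def IsHubIn {α : Type} (G : SimpleGraph α) (W : Set α) (x : α) : Prop :=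
  x ∈ W ∧ ∃ H : Set α, H ⊆ W ∧ IsProperWheel G H x

/-- `x` is a hub of `G`: the center of some proper wheel. -/
def IsHub {α : Type} (G : SimpleGraph α) (x : α) : Prop :=
  ∃ H : Set α, IsProperWheel G H x

/-- membership in the class `𝒞` of (C₄, theta, prism, even wheel)-free graphs. -/
def MemC {α : Type} (G : SimpleGraph α) : Prop :=
  (∀ H : Set α, IsHole G H → H.ncard ≠ 4) ∧ ¬ HasTheta G ∧ ¬ HasPrism G ∧
    (∀ (H : Set α) (x : α), IsWheel G H x → ¬ Even (holeNbrs G H x).ncard)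

/-- membership in the class `𝒞ₜ`: graphs in `𝒞` with no clique of size `t`. -/
def MemCt {α : Type} (t : ℕ) (G : SimpleGraph α) : Prop :=
  MemC G ∧ G.CliqueFree t

/-- `G` contains a generalized `k`-pyramid as an induced subgraph. -/
def ContainsGenPyramid {α : Type} (G : SimpleGraph α) (k : ℕ) : Prop :=
  ∃ (nP nQ : ℕ) (P : Fin nP → α) (Q : Fin nQ → α)
    (m : Fin k → ℕ) (R : ∀ i, Fin (m i) → α) (xI zI : Fin k → ℕ),
    4 ≤ nP + nQ ∧ 1 ≤ nP ∧ 1 ≤ nQ ∧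
    IsPathEmb G nP P ∧ IsPathEmb G nQ Q ∧
    (∀ i j, P i ≠ Q j) ∧
    (∀ (i : Fin nP) (j : Fin nQ), G.Adj (P i) (Q j) ↔
      ((i.val = 0 ∧ j.val = 0) ∨ (i.val = nP - 1 ∧ j.val = nQ - 1))) ∧
    (∀ i, 1 ≤ m i) ∧ (∀ i, IsPathEmb G (m i) (R i)) ∧
    (∀ i u j, R i u ≠ P j) ∧ (∀ i u j, R i u ≠ Q j) ∧
    (∀ i i', i ≠ i' → ∀ u u', R i u ≠ R i' u' ∧ ¬ G.Adj (R i u) (R i' u')) ∧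
    (∀ i, 0 < xI i ∧ xI i + 1 < nP - 1) ∧
    (∀ (i : Fin k) (u : Fin (m i)) (j : Fin nP), G.Adj (R i u) (P j) ↔
      (u.val = 0 ∧ (j.val = xI i ∨ j.val = xI i + 1))) ∧
    (∀ i, zI i < nQ) ∧
    (∀ (i : Fin k) (u : Fin (m i)) (j : Fin nQ), G.Adj (R i u) (Q j) ↔
      (u.val = m i - 1 ∧ j.val = zI i)) ∧
    (∀ i i' : Fin k, i < i' → xI i + 1 < xI i') ∧
    (∀ i i' : Fin k, i ≤ i' → zI i ≤ zI i')

/-- membership in the class `𝒞ₜₜ`: graphs in `𝒞ₜ` with no induced generalized `t`-pyramid. -/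
def MemCtt {α : Type} (t : ℕ) (G : SimpleGraph α) : Prop :=
  MemCt t G ∧ ¬ ContainsGenPyramid G t

/-- `(T, χ)` is a tree decomposition of `G`. -/
structure IsTD {α ι : Type} (G : SimpleGraph α) (T : SimpleGraph ι) (χ : ι → Set α) : Prop where
  finite : Finite ι
  isTree : T.IsTree
  memBag : ∀ v : α, ∃ t, v ∈ χ t
  edgeBag : ∀ ⦃u v : α⦄, G.Adj u v → ∃ t, u ∈ χ t ∧ v ∈ χ t
  subtree : ∀ v : α, (T.induce {t | v ∈ χ t}).Connected

/-- `G` has a tree decomposition of width at most `w`. -/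
def TwLE {α : Type} (G : SimpleGraph α) (w : ℕ) : Prop :=
  ∃ (ι : Type) (T : SimpleGraph ι) (χ : ι → Set α),
    IsTD G T χ ∧ ∀ t, (χ t).ncard ≤ w + 1

/-- The treewidth of `G`. -/
noncomputable def treeWidth {α : Type} (G : SimpleGraph α) : ℕ :=
  sInf {w | TwLE G w}

/-- For adjacent `t, t'` in a tree `T`, the vertex set of the component of `T - t`
containing `t'`. -/
def branchSet {ι : Type} (T : SimpleGraph ι) (t t' : ι) : Set ι :=
  {s | ∀ w : T.Walk s t, t' ∈ w.support}

/-- The vertex set of `G_{t → t'}`: the union of the bags over the component of `T - t`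
containing `t'`. -/
def sideSet {α ι : Type} (T : SimpleGraph ι) (χ : ι → Set α) (t t' : ι) : Set α :=
  ⋃ s ∈ branchSet T t t', χ s

/-- `(T, χ)` is a tight tree decomposition of `G`. -/
def TightTD {α ι : Type} (G : SimpleGraph α) (T : SimpleGraph ι) (χ : ι → Set α) : Prop :=
  IsTD G T χ ∧ ∀ ⦃t t' : ι⦄, T.Adj t t' →
    ∃ D, IsCompOf G (sideSet T χ t t' \ χ t) D ∧ setNbhd G D = χ t ∩ χ t'

/-- `G` admits a clique cutset. -/
def HasCliqueCutset {α : Type} (G : SimpleGraph α) : Prop :=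
  ∃ C : Set α, G.IsClique C ∧ ¬ (G.induce (Set.univ \ C)).Preconnected

/-- `G` is chordal: it has no hole. -/
def ChordalG {α : Type} (G : SimpleGraph α) : Prop := ∀ H : Set α, ¬ IsHole G H

/-- `G'` is a minimal chordal completion of `G`. -/
def IsMinChordalCompletion {α : Type} (G G' : SimpleGraph α) : Prop :=
  G ≤ G' ∧ ChordalG G' ∧ ∀ G'', G ≤ G'' → G'' ≤ G' → ChordalG G'' → G'' = G'

/-- `Ω` is a potential maximal clique of `G` : a maximal clique of some minimal chordal
completion of `G`. -/
def IsPMC {α : Type} (G : SimpleGraph α) (Ω : Set α) : Prop :=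
  ∃ G' : SimpleGraph α, IsMinChordalCompletion G G' ∧ G'.IsClique Ω ∧
    ∀ Ω' : Set α, G'.IsClique Ω' → Ω ⊆ Ω' → Ω' = Ω

/-- `(T, χ)` is a structured tree decomposition: every bag is a PMC of `G`. -/
def StructuredTD {α ι : Type} (G : SimpleGraph α) (T : SimpleGraph ι) (χ : ι → Set α) : Prop :=
  IsTD G T χ ∧ ∀ t, IsPMC G (χ t)

/-- the decomposition has adhesion less than `m`. -/
def AdhLT {α ι : Type} (T : SimpleGraph ι) (χ : ι → Set α) (m : ℕ) : Prop :=
  ∀ ⦃t t' : ι⦄, T.Adj t t' → (χ t ∩ χ t').ncard < m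

/-- `fatness χ i` is the number of bags of size `i`. -/
noncomputable def fatness {α ι : Type} (χ : ι → Set α) (i : ℕ) : ℕ :=
  {t : ι | (χ t).ncard = i}.ncard

/-- Lexicographic comparison of fatness vectors `(aₙ, …, a₀)` (larger sizes more
significant). -/
def FatLexLE (f g : ℕ → ℕ) : Prop :=
  (∀ i, f i = g i) ∨ ∃ j, f j < g j ∧ ∀ i, j < i → f i = g i

/-- `(T, χ)` is an `m`-atomic tree decomposition of `G`: its adhesion is less than `m` and its
fatness is lexicographically minimum among all tree decompositions with adhesion less than `m`. -/
def IsAtomicTD {α ι : Type} (m : ℕ) (G : SimpleGraph α) (T : SimpleGraph ι)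
    (χ : ι → Set α) : Prop :=
  IsTD G T χ ∧ AdhLT T χ m ∧
    ∀ (ι' : Type) (T' : SimpleGraph ι') (χ' : ι' → Set α),
      IsTD G T' χ' → AdhLT T' χ' m → FatLexLE (fatness χ) (fatness χ')

/-- Adjacency in the torso at the node `x` of the tree decomposition. -/
def torsoAdj {α ι : Type} (G : SimpleGraph α) (T : SimpleGraph ι) (χ : ι → Set α)
    (x : ι) (u v : α) : Prop :=
  u ∈ χ x ∧ v ∈ χ x ∧ u ≠ v ∧
    (G.Adj u v ∨ ∃ y, T.Adj x y ∧ u ∈ χ y ∧ v ∈ χ y)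

/-- The degree of `u` in the torso at `x`. -/
noncomputable def torsoDeg {α ι : Type} (G : SimpleGraph α) (T : SimpleGraph ι)
    (χ : ι → Set α) (x : ι) (u : α) : ℕ :=
  {v | torsoAdj G T χ x u v}.ncard

/-- `u` and `v` lie in the same component of `G[S]`. -/
def SameComp {α : Type} (G : SimpleGraph α) (S : Set α) (u v : α) : Prop :=
  ∃ (hu : u ∈ S) (hv : v ∈ S), (G.induce S).Reachable ⟨u, hu⟩ ⟨v, hv⟩

/-- `X` is a minimal separator of `G`. -/
def IsMinimalSeparator {α : Type} (G : SimpleGraph α) (X : Set α) : Prop :=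
  ∃ u v : α, u ∉ X ∧ v ∉ X ∧ ¬ SameComp G (Set.univ \ X) u v ∧
    ∀ Y : Set α, Y ⊂ X → SameComp G (Set.univ \ Y) u v
/-- The degree of `v` in `H` (as the cardinality of its neighbor set). -/
noncomputable def degreeSet {α : Type} (H : SimpleGraph α) (v : α) : ℕ :=
  (H.neighborSet v).ncard

/-- `H` is a path (as a graph). -/
def IsPathGraph {α : Type} (H : SimpleGraph α) : Prop :=
  ∃ (n : ℕ) (f : Fin n → α), Function.Bijective f ∧
    ∀ i j, H.Adj (f i) (f j) ↔ (i.val = j.val + 1 ∨ j.val = i.val + 1)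

/-- `H` is a caterpillar: a tree of maximum degree three having a path containing all
branch vertices. -/
def IsCaterpillar {α : Type} (H : SimpleGraph α) : Prop :=
  H.IsTree ∧ (∀ v, degreeSet H v ≤ 3) ∧
    ∃ (n : ℕ) (f : Fin n → α), IsPathEmb H n f ∧
      ∀ v, 2 < degreeSet H v → v ∈ Set.range f

/-- `H` is a subdivided star: a tree with exactly one branch vertex (its root), of degree
at least 3. -/
def IsSubdividedStar {α : Type} (H : SimpleGraph α) : Prop :=
  H.IsTree ∧ ∃! r, 2 < degreeSet H r

/-- `H` is (isomorphic to) the line graph of a caterpillar. -/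
def IsLineGraphOfCaterpillar {α : Type} (H : SimpleGraph α) : Prop :=
  ∃ (β : Type) (C : SimpleGraph β), IsCaterpillar C ∧
    Nonempty (SimpleGraph.Iso H C.lineGraph)

/-- `w` is a simplicial vertex of the induced subgraph `G[W]`. -/
def SimplicialIn {α : Type} (G : SimpleGraph α) (W : Set α) (w : α) : Prop :=
  w ∈ W ∧ G.IsClique {u | u ∈ W ∧ G.Adj w u}

/-- `(p, x)` is an alignment: `p` enumerates an induced path, `x` enumerates the set `X`
in the order given by the alignment. -/
structure IsAlignment {α : Type} (G : SimpleGraph α) (n : ℕ) (p : Fin n → α)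
    (k : ℕ) (x : Fin k → α) : Prop where
  hn : 1 ≤ n
  hk : 2 ≤ k
  path : IsPathEmb G n p
  injx : Function.Injective x
  disj : ∀ i j, x i ≠ p j
  cover : ∀ i, ∃ j, G.Adj (x i) (p j)
  first : ∀ j : Fin n, G.Adj (x ⟨0, by omega⟩) (p j) ↔ j.val = 0
  last : ∀ j : Fin n, G.Adj (x ⟨k - 1, by omega⟩) (p j) ↔ j.val = n - 1
  ordered : ∀ (i i' : Fin k) (j j' : Fin n),
    i < i' → G.Adj (x i) (p j) → G.Adj (x i') (p j') → j < j'

/-- A wide alignment: every middle vertex of `X` has two non-adjacent neighbors in `P`. -/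
def IsWideAlignment {α : Type} (G : SimpleGraph α) (n : ℕ) (p : Fin n → α)
    (k : ℕ) (x : Fin k → α) : Prop :=
  IsAlignment G n p k x ∧ ∀ i : Fin k, 0 < i.val → i.val < k - 1 →
    ∃ j j' : Fin n, j.val + 1 < j'.val ∧ G.Adj (x i) (p j) ∧ G.Adj (x i) (p j')

/-- A spiky alignment: every middle vertex of `X` has a unique neighbor in `P`. -/
def IsSpikyAlignment {α : Type} (G : SimpleGraph α) (n : ℕ) (p : Fin n → α)
    (k : ℕ) (x : Fin k → α) : Prop :=
  IsAlignment G n p k x ∧ ∀ i : Fin k, 0 < i.val → i.val < k - 1 →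
    ∃! j : Fin n, G.Adj (x i) (p j)

/-- A triangular alignment: every middle vertex of `X` has exactly two neighbors in `P`,
and they are adjacent. -/
def IsTriangularAlignment {α : Type} (G : SimpleGraph α) (n : ℕ) (p : Fin n → α)
    (k : ℕ) (x : Fin k → α) : Prop :=
  IsAlignment G n p k x ∧ ∀ i : Fin k, 0 < i.val → i.val < k - 1 →
    ∃ j : Fin n, j.val + 1 < n ∧
      ∀ j' : Fin n, G.Adj (x i) (p j') ↔ (j'.val = j.val ∨ j'.val = j.val + 1)

/-- `(H, x)` is a spiky connectifier: `H` is an induced caterpillar with spine `p` and legs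
`ℓ`, and `x` enumerates `X` in the order given by the connectifier (`x 0` and `x (k-1)`
attached at the ends of the spine, the others to the tips of the legs, in the order in which
the legs attach along the spine). -/
def IsSpikyConnectifier {α : Type} (G : SimpleGraph α) (H : Set α)
    (k : ℕ) (x : Fin k → α) : Prop :=
  ∃ (hk : 2 ≤ k) (n : ℕ) (_ : 2 ≤ n) (p : Fin n → α)
    (m : Fin (k - 2) → ℕ) (ℓ : ∀ i, Fin (m i) → α) (a : Fin (k - 2) → ℕ),
    IsPathEmb G n p ∧ (∀ i, 1 ≤ m i) ∧ (∀ i, IsPathEmb G (m i) (ℓ i)) ∧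
    H = Set.range p ∪ ⋃ i, Set.range (ℓ i) ∧
    Function.Injective x ∧ (∀ i, x i ∉ H) ∧
    (∀ i j j', ℓ i j ≠ p j') ∧
    (∀ i i', i ≠ i' → ∀ j j', ℓ i j ≠ ℓ i' j' ∧ ¬ G.Adj (ℓ i j) (ℓ i' j')) ∧
    (∀ i, 0 < a i ∧ a i < n - 1) ∧
    (∀ i i', i < i' → a i < a i') ∧
    (∀ (i : Fin (k - 2)) (j : Fin (m i)) (j' : Fin n),
      G.Adj (ℓ i j) (p j') ↔ (j.val = 0 ∧ j'.val = a i)) ∧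
    (∀ j : Fin n, G.Adj (x ⟨0, by omega⟩) (p j) ↔ j.val = 0) ∧
    (∀ (i : Fin (k - 2)) (j : Fin (m i)), ¬ G.Adj (x ⟨0, by omega⟩) (ℓ i j)) ∧
    (∀ j : Fin n, G.Adj (x ⟨k - 1, by omega⟩) (p j) ↔ j.val = n - 1) ∧
    (∀ (i : Fin (k - 2)) (j : Fin (m i)), ¬ G.Adj (x ⟨k - 1, by omega⟩) (ℓ i j)) ∧
    (∀ (i : Fin (k - 2)) (j : Fin n),
      ¬ G.Adj (x ⟨i.val + 1, by have := i.isLt; omega⟩) (p j)) ∧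
    (∀ (i i' : Fin (k - 2)) (j : Fin (m i')),
      G.Adj (x ⟨i.val + 1, by have := i.isLt; omega⟩) (ℓ i' j) ↔ (i' = i ∧ j.val = m i' - 1))

/-- `(H, x)` is a triangular connectifier: `H` is the line graph of a caterpillar, with
spine `p` and legs `ℓ` attached along triangles, and `x` enumerates `X` in the order given
by the connectifier. -/
def IsTriangularConnectifier {α : Type} (G : SimpleGraph α) (H : Set α)
    (k : ℕ) (x : Fin k → α) : Prop :=
  ∃ (hk : 2 ≤ k) (n : ℕ) (_ : 2 ≤ n) (p : Fin n → α)
    (m : Fin (k - 2) → ℕ) (ℓ : ∀ i, Fin (m i) → α) (a : Fin (k - 2) → ℕ),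
    IsPathEmb G n p ∧ (∀ i, 1 ≤ m i) ∧ (∀ i, IsPathEmb G (m i) (ℓ i)) ∧
    H = Set.range p ∪ ⋃ i, Set.range (ℓ i) ∧
    Function.Injective x ∧ (∀ i, x i ∉ H) ∧
    (∀ i j j', ℓ i j ≠ p j') ∧
    (∀ i i', i ≠ i' → ∀ j j', ℓ i j ≠ ℓ i' j' ∧ ¬ G.Adj (ℓ i j) (ℓ i' j')) ∧
    (∀ i, a i + 1 ≤ n - 1) ∧
    (∀ i i', i < i' → a i < a i') ∧
    (∀ (i : Fin (k - 2)) (j : Fin (m i)) (j' : Fin n),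
      G.Adj (ℓ i j) (p j') ↔ (j.val = 0 ∧ (j'.val = a i ∨ j'.val = a i + 1))) ∧
    (∀ j : Fin n, G.Adj (x ⟨0, by omega⟩) (p j) ↔ j.val = 0) ∧
    (∀ (i : Fin (k - 2)) (j : Fin (m i)), ¬ G.Adj (x ⟨0, by omega⟩) (ℓ i j)) ∧
    (∀ j : Fin n, G.Adj (x ⟨k - 1, by omega⟩) (p j) ↔ j.val = n - 1) ∧
    (∀ (i : Fin (k - 2)) (j : Fin (m i)), ¬ G.Adj (x ⟨k - 1, by omega⟩) (ℓ i j)) ∧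
    (∀ (i : Fin (k - 2)) (j : Fin n),
      ¬ G.Adj (x ⟨i.val + 1, by have := i.isLt; omega⟩) (p j)) ∧
    (∀ (i i' : Fin (k - 2)) (j : Fin (m i')),
      G.Adj (x ⟨i.val + 1, by have := i.isLt; omega⟩) (ℓ i' j) ↔ (i' = i ∧ j.val = m i' - 1))

/-- `(H, x)` is a stellar connectifier: `H` is an induced subdivided star with root `r` and
legs `ℓ`, and the vertices of `X` are attached to the tips of the legs. -/
def IsStellarConnectifier {α : Type} (G : SimpleGraph α) (H : Set α)
    (k : ℕ) (x : Fin k → α) : Prop :=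
  ∃ (_ : 3 ≤ k) (r : α) (m : Fin k → ℕ) (ℓ : ∀ i, Fin (m i) → α),
    (∀ i, 1 ≤ m i) ∧ (∀ i, IsPathEmb G (m i) (ℓ i)) ∧
    H = {r} ∪ ⋃ i, Set.range (ℓ i) ∧
    Function.Injective x ∧ (∀ i, x i ∉ H) ∧
    (∀ i j, ℓ i j ≠ r) ∧
    (∀ i i', i ≠ i' → ∀ j j', ℓ i j ≠ ℓ i' j' ∧ ¬ G.Adj (ℓ i j) (ℓ i' j')) ∧
    (∀ (i : Fin k) (j : Fin (m i)), G.Adj r (ℓ i j) ↔ j.val = 0) ∧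
    (∀ i, ¬ G.Adj (x i) r) ∧
    (∀ (i i' : Fin k) (j : Fin (m i')),
      G.Adj (x i) (ℓ i' j) ↔ (i' = i ∧ j.val = m i' - 1))

/-- `(H, X)` is a wide alignment (set version). -/
def IsWideAlignSet {α : Type} (G : SimpleGraph α) (H X : Set α) : Prop :=
  ∃ (n k : ℕ) (p : Fin n → α) (e : Fin k → α),
    H = Set.range p ∧ X = Set.range e ∧ IsWideAlignment G n p k e

/-- `(H, X)` is a spiky alignment (set version). -/
def IsSpikyAlignSet {α : Type} (G : SimpleGraph α) (H X : Set α) : Prop :=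
  ∃ (n k : ℕ) (p : Fin n → α) (e : Fin k → α),
    H = Set.range p ∧ X = Set.range e ∧ IsSpikyAlignment G n p k e

/-- `(H, X)` is a triangular alignment (set version). -/
def IsTriAlignSet {α : Type} (G : SimpleGraph α) (H X : Set α) : Prop :=
  ∃ (n k : ℕ) (p : Fin n → α) (e : Fin k → α),
    H = Set.range p ∧ X = Set.range e ∧ IsTriangularAlignment G n p k e

/-- `(H, X)` is a spiky connectifier (set version). -/
def IsSpikyConnSet {α : Type} (G : SimpleGraph α) (H X : Set α) : Prop :=
  ∃ (k : ℕ) (e : Fin k → α), X = Set.range e ∧ IsSpikyConnectifier G H k e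

/-- `(H, X)` is a triangular connectifier (set version). -/
def IsTriConnSet {α : Type} (G : SimpleGraph α) (H X : Set α) : Prop :=
  ∃ (k : ℕ) (e : Fin k → α), X = Set.range e ∧ IsTriangularConnectifier G H k e

/-- `(H, X)` is a stellar connectifier (set version). -/
def IsStellarConnSet {α : Type} (G : SimpleGraph α) (H X : Set α) : Prop :=
  ∃ (k : ℕ) (e : Fin k → α), X = Set.range e ∧ IsStellarConnectifier G H k e

/-- `(H, X)` (with order `e` on `X`) is a consistent alignment or consistent connectifier. -/
def IsConsistentWith {α : Type} (G : SimpleGraph α) (H : Set α)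
    (k : ℕ) (e : Fin k → α) : Prop :=
  (∃ (n : ℕ) (p : Fin n → α), H = Set.range p ∧
    (IsWideAlignment G n p k e ∨ IsSpikyAlignment G n p k e ∨ IsTriangularAlignment G n p k e)) ∨
  IsSpikyConnectifier G H k e ∨ IsTriangularConnectifier G H k e ∨
    IsStellarConnectifier G H k e

namespace SimpleGraph

/-- If `m` is a vertex of a connected set `S` closest to `r`, then from every vertex of `S` there is
a path to `r` that stays inside `S` until it reaches `m`. -/
lemma Connected.exists_isPath_through_closest {ι : Type} {T : SimpleGraph ι} (hT : T.Connected)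
    {S : Set ι} (hS : (T.induce S).Connected) {r t m : ι} (ht : t ∈ S) (hm : m ∈ S)
    (hmin : ∀ s ∈ S, T.dist m r ≤ T.dist s r) :
    ∃ p : T.Walk t r, p.IsPath ∧ ∃ i, i + T.dist m r = p.length ∧ p.getVert i = m ∧
      ∀ k ≤ i, p.getVert k ∈ S := by
  classical
  obtain ⟨q₀, hq₀⟩ := (hS.preconnected ⟨t, ht⟩ ⟨m, hm⟩).exists_isPath
  obtain ⟨q, hq, hlen⟩ := hT.exists_path_of_dist m r
  let p₀ : T.Walk t m := q₀.map (Embedding.induce S).toHom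
  have hp₀ : p₀.IsPath := hq₀.map (Embedding.induce (G := T) S).injective
  have hsupp : ∀ x ∈ p₀.support, x ∈ S := by
    intro x hx
    obtain ⟨y, -, rfl⟩ := List.mem_map.1 (Walk.support_map (Embedding.induce S).toHom q₀ ▸ hx)
    exact y.2
  refine ⟨p₀.append q, ?_, p₀.length, by simp [hlen], by simp [Walk.getVert_append], ?_⟩
  · rw [Walk.isPath_def, Walk.support_append, List.nodup_append']
    refine ⟨hp₀.support_nodup, hq.support_nodup.tail, ?_⟩
    intro x hx hxq
    have hxm : x ≠ m := by
      rintro rfl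
      have := hq.support_nodup
      rw [← Walk.cons_tail_support, List.nodup_cons] at this
      exact this.1 hxq
    have hxs : x ∈ q.support := List.mem_of_mem_tail hxq
    have h1 := Walk.length_dropUntil_lt_length hxs hxm
    have h2 := dist_le (q.dropUntil x hxs)
    have h3 := hmin x (hsupp x hx)
    omega
  · intro k hk
    rw [Walk.getVert_append', if_pos hk]
    exact hsupp _ (Walk.getVert_mem_support _ _)

end SimpleGraph

/-- The graph in which two distinct vertices are adjacent when they share a bag. -/
def bagGraph {α ι : Type} (χ : ι → Set α) : SimpleGraph α where
  Adj u v := u ≠ v ∧ ∃ t, u ∈ χ t ∧ v ∈ χ t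
  symm := ⟨fun _ _ ⟨h, t, hu, hv⟩ => ⟨h.symm, t, hv, hu⟩⟩
  loopless := ⟨fun _ h => h.1 rfl⟩

namespace IsTD

variable {α ι : Type} {G : SimpleGraph α} {T : SimpleGraph ι} {χ : ι → Set α}

lemma le_bagGraph (h : IsTD G T χ) : G ≤ bagGraph χ :=
  fun _ _ huv => ⟨huv.ne, h.edgeBag huv⟩

/-- After rooting the tree, every vertex has a highest bag; among two vertices sharing a bag, the
one whose highest bag is nearer to the root also lies in the highest bag of the other. -/
lemma exists_depth_top (h : IsTD G T χ) :
    ∃ (d : α → ℕ) (top : α → ι), (∀ v, v ∈ χ (top v)) ∧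
      ∀ u v t, u ∈ χ t → v ∈ χ t → d u ≤ d v → u ∈ χ (top v) := by
  classical
  have hT := h.isTree.connected
  obtain ⟨r⟩ := hT.nonempty
  have hex : ∀ v, ∃ m, v ∈ χ m ∧ ∀ s, v ∈ χ s → T.dist m r ≤ T.dist s r := by
    intro v
    obtain ⟨m, hm, hmin⟩ := exists_minimalFor_of_wellFoundedLT (fun t => v ∈ χ t)
      (fun t => T.dist t r) (h.memBag v)
    exact ⟨m, hm, fun s hs => (le_total _ _).elim id (hmin hs)⟩
  choose top hmem hmin using hex
  refine ⟨fun v => T.dist (top v) r, top, hmem, fun u v t hu hv huv => ?_⟩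
  obtain ⟨p, hp, i, hi, -, hpi⟩ := hT.exists_isPath_through_closest
    (h.subtree u) hu (hmem u) (hmin u)
  obtain ⟨q, hq, j, hj, hqj, -⟩ := hT.exists_isPath_through_closest
    (h.subtree v) hv (hmem v) (hmin v)
  have hpq : p = q := congrArg Subtype.val
    ((h.isTree.isAcyclic.subsingleton_path t r).elim ⟨p, hp⟩ ⟨q, hq⟩)
  subst hpq
  have := hpi j (by simp only at huv; omega)
  rwa [hqj] at this

lemma exists_bag_of_isClique_bagGraph [Finite α] (h : IsTD G T χ) {K : Set α}
    (hK : (bagGraph χ).IsClique K) : ∃ t, K ⊆ χ t := by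
  obtain ⟨d, top, hmem, htop⟩ := h.exists_depth_top
  rcases K.eq_empty_or_nonempty with rfl | hne
  · exact ⟨h.isTree.connected.nonempty.some, empty_subset _⟩
  obtain ⟨v, hv, hmax⟩ := K.toFinite.exists_maximalFor d K hne
  refine ⟨top v, fun u hu => ?_⟩
  by_cases huv : u = v
  · exact huv ▸ hmem u
  obtain ⟨-, t, hut, hvt⟩ := hK hu hv huv
  exact htop u v t hut hvt ((le_total _ _).elim id (hmax hu))

lemma chordalG_bagGraph (h : IsTD G T χ) : ChordalG (bagGraph χ) := by
  rintro H ⟨n, f, hn, ⟨hinj, hadj⟩, -⟩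
  have : NeZero n := ⟨by omega⟩
  obtain ⟨d, top, -, htop⟩ := h.exists_depth_top
  obtain ⟨i, hmax⟩ := Finite.exists_max (d ∘ f)
  have hnbr : ∀ j, (bagGraph χ).Adj (f j) (f i) → f j ∈ χ (top (f i)) := by
    rintro j ⟨-, t, hj, hi⟩
    exact htop _ _ t hj hi (hmax j)
  have hcast : ∀ k : ℕ, 0 < k → k < 4 → (k : ZMod n) ≠ 0 := by
    intro k hk hk4 h0
    rw [ZMod.natCast_eq_zero_iff] at h0
    exact absurd (Nat.le_of_dvd hk h0) (by omega)
  have h1 := hcast 1 (by norm_num) (by norm_num)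
  have h2 := hcast 2 (by norm_num) (by norm_num)
  have h3 := hcast 3 (by norm_num) (by norm_num)
  push_cast at h1 h2 h3
  have hne : f (i + 1) ≠ f (i - 1) := fun he => h2 (by linear_combination hinj he)
  have := (hadj (i + 1) (i - 1)).1 ⟨hne, top (f i), hnbr _ ((hadj _ _).2 (Or.inl rfl)),
    hnbr _ ((hadj _ _).2 (Or.inr (by ring)))⟩
  rcases this with h | h
  · exact h1 (by linear_combination h)
  · exact h3 (by linear_combination -h)

end IsTD

lemma exists_isMinChordalCompletion_le {α : Type} [Finite α] {G H : SimpleGraph α} (hGH : G ≤ H)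
    (hH : ChordalG H) : ∃ G', IsMinChordalCompletion G G' ∧ G' ≤ H := by
  obtain ⟨G', hle, hmin⟩ := exists_minimal_le_of_wellFoundedLT
    (fun K : SimpleGraph α => G ≤ K ∧ ChordalG K) H ⟨hGH, hH⟩
  exact ⟨G', ⟨hmin.prop.1, hmin.prop.2, fun K hGK hK hc => hmin.eq_of_le ⟨hGK, hc⟩ hK⟩, hle⟩

/-- An induced path with at least three vertices, together with a vertex adjacent exactly to its
two ends, forms a hole. -/
lemma exists_isHole_of_inducedPath {α : Type} {G : SimpleGraph α} {n : ℕ} (hn : 2 ≤ n)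
    {p : ℕ → α} {x : α} (hinj : ∀ i ≤ n, ∀ j ≤ n, p i = p j → i = j)
    (hadj : ∀ i ≤ n, ∀ j ≤ n, G.Adj (p i) (p j) ↔ i = j + 1 ∨ j = i + 1)
    (hne : ∀ i ≤ n, p i ≠ x) (hx : ∀ i ≤ n, G.Adj x (p i) ↔ i = 0 ∨ i = n) :
    ∃ H, IsHole G H := by
  let f : ZMod (n + 2) → α := fun i => if i.val = n + 1 then x else p i.val
  have hlt : ∀ i : ZMod (n + 2), i.val < n + 2 := ZMod.val_lt
  have hsucc : ∀ i j : ZMod (n + 2),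
      i = j + 1 ↔ i.val = j.val + 1 ∨ (i.val = 0 ∧ j.val = n + 1) := by
    intro i j
    have : Fact (1 < n + 2) := ⟨by omega⟩
    rw [← (ZMod.val_injective (n + 2)).eq_iff, ZMod.val_add, ZMod.val_one]
    have hi := hlt i
    have hj := hlt j
    by_cases h : j.val = n + 1
    · rw [h, Nat.mod_self]
      omega
    · rw [Nat.mod_eq_of_lt (by omega)]
      omega
  refine ⟨Set.range f, n + 2, f, by omega, ⟨?_, ?_⟩, rfl⟩
  · intro i j hij
    have hi := hlt i
    have hj := hlt j
    apply ZMod.val_injective (n + 2)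
    simp only [f] at hij
    split_ifs at hij with h1 h2 h2
    · omega
    · exact absurd hij.symm (hne _ (by omega))
    · exact absurd hij (hne _ (by omega))
    · exact hinj _ (by omega) _ (by omega) hij
  · intro i j
    have hi := hlt i
    have hj := hlt j
    rw [hsucc, hsucc]
    simp only [f]
    split_ifs with h1 h2 h2
    · simp only [SimpleGraph.irrefl, false_iff]
      omega
    · rw [hx _ (by omega)]
      omega
    · rw [G.adj_comm, hx _ (by omega)]
      omega
    · rw [hadj _ (by omega) _ (by omega)]
      omega

namespace ChordalG

variable {α : Type} {G : SimpleGraph α}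

/-- In a chordal graph, two distinct neighbors of `x` joined by a path whose interior avoids the
closed neighborhood of `x` are adjacent. -/
lemma adj_of_reachable_avoiding_nbhd (hG : ChordalG G) {D : Set α} {u w : D} {x : α} (huw : u ≠ w)
    (hr : (G.induce D).Reachable u w) (hxu : G.Adj x u) (hxw : G.Adj x w)
    (hD : ∀ c : D, c ≠ u → c ≠ w → (c : α) ≠ x ∧ ¬ G.Adj x c) : G.Adj u w := by
  by_contra hnadj
  obtain ⟨p, -, hlen⟩ := hr.exists_path_of_dist
  have hlt : 1 < p.length :=
    hlen ▸ hr.one_lt_dist_of_ne_of_not_adj huw (by simpa using hnadj)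
  have hdist : ∀ i ≤ p.length, (G.induce D).dist u (p.getVert i) = i := by
    intro i hi
    have := SimpleGraph.length_eq_dist_of_subwalk hlen (p.isSubwalk_take i)
    rw [SimpleGraph.Walk.take_length] at this
    omega
  have hinj : ∀ i ≤ p.length, ∀ j ≤ p.length, p.getVert i = p.getVert j → i = j := by
    intro i hi j hj hij
    rw [← hdist i hi, ← hdist j hj, hij]
  have hend : ∀ i ≤ p.length, i ≠ 0 → i ≠ p.length →
      (p.getVert i : α) ≠ x ∧ ¬ G.Adj x (p.getVert i) := by
    intro i hi h0 hl
    refine hD _ (fun h => h0 ?_) (fun h => hl ?_)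
    · exact hinj i hi 0 (by omega) (by simpa using h)
    · exact hinj i hi p.length le_rfl (by simpa using h)
  refine not_exists.2 hG (exists_isHole_of_inducedPath (G := G) (n := p.length) hlt
    (p := fun i => (p.getVert i : α)) (x := x)
    (fun i hi j hj hij => hinj i hi j hj (Subtype.ext hij)) ?_ ?_ ?_)
  · intro i hi j hj
    constructor
    · intro hij
      have hadj : (G.induce D).Adj (p.getVert i) (p.getVert j) := hij
      have h1 := hadj.diff_dist_adj (u := u)
      rw [hdist i hi, hdist j hj] at h1
      have : i ≠ j := by
        rintro rfl
        exact hadj.ne rfl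
      omega
    · rintro (rfl | rfl)
      · exact (p.adj_getVert_succ (by omega)).symm
      · exact p.adj_getVert_succ (by omega)
  · intro i hi
    by_cases h0 : i = 0
    · subst h0
      simpa using hxu.ne'
    by_cases hl : i = p.length
    · subst hl
      simpa using hxw.ne'
    exact (hend i hi h0 hl).1
  · intro i hi
    constructor
    · intro hxi
      by_contra! hcon
      exact (hend i hi hcon.1 hcon.2).2 hxi
    · rintro (rfl | rfl)
      · simpa using hxu
      · simpa using hxw

variable [Finite α]

/-- Dirac: in a chordal graph, a vertex with a non-neighbor has a simplicial non-neighbor. -/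
lemma exists_simplicialIn_not_adj (hG : ChordalG G) (S : Set α) {x z : α} (hx : x ∈ S)
    (hz : z ∈ S) (hzx : z ≠ x) (hxz : ¬ G.Adj x z) :
    ∃ y, SimplicialIn G S y ∧ y ≠ x ∧ ¬ G.Adj x y := by
  induction S using WellFoundedLT.induction generalizing x z with
  | ind S ih =>
  obtain ⟨C, ⟨hCS, hzC, hC⟩, hmax⟩ := (Set.toFinite {C : Set α |
    C ⊆ {v | v ∈ S ∧ v ≠ x ∧ ¬ G.Adj x v} ∧ z ∈ C ∧ (G.induce C).Connected}).exists_maximal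
      ⟨{z}, by simp [hz, hzx, hxz], rfl, SimpleGraph.connected_top.mono (by simp)⟩
  have hCmem : ∀ c ∈ C, ∀ v ∈ S, v ≠ x → ¬ G.Adj x v → G.Adj c v → v ∈ C := by
    intro c hc v hv hvx hxv hcv
    refine hmax (y := C ∪ {v}) ⟨?_, Or.inl hzC, ?_⟩ subset_union_left (Or.inr rfl)
    · rintro a (ha | rfl)
      · exact hCS ha
      · exact ⟨hv, hvx, hxv⟩
    · exact SimpleGraph.connected_induce_union hC.preconnected
        (SimpleGraph.Preconnected.of_subsingleton) hc rfl hcv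
  let B : Set α := {b | b ∈ S ∧ G.Adj x b ∧ ∃ c ∈ C, G.Adj b c}
  have hB : G.IsClique B := by
    rintro u ⟨-, hxu, c, hc, huc⟩ w ⟨-, hxw, c', hc', hwc'⟩ huw
    have h1 : (G.induce (C ∪ {w})).Connected :=
      SimpleGraph.connected_induce_union hC.preconnected
        SimpleGraph.Preconnected.of_subsingleton hc' rfl hwc'.symm
    have h2 : (G.induce (C ∪ {w} ∪ {u})).Connected :=
      SimpleGraph.connected_induce_union h1.preconnected
        SimpleGraph.Preconnected.of_subsingleton (Or.inl hc) rfl huc.symm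
    refine hG.adj_of_reachable_avoiding_nbhd (D := C ∪ {w} ∪ {u}) (u := ⟨u, Or.inr rfl⟩)
      (w := ⟨w, Or.inl (Or.inr rfl)⟩) (fun h => huw (congrArg Subtype.val h))
      (h2.preconnected _ _) hxu hxw ?_
    rintro ⟨a, (ha | rfl) | rfl⟩ hau haw
    · exact (hCS ha).2
    · exact absurd rfl haw
    · exact absurd rfl hau
  have hlt : C ∪ B < S := by
    refine ⟨union_subset (fun c hc => (hCS hc).1) (fun b hb => hb.1), fun hS => ?_⟩
    rcases hS hx with h | h
    · exact (hCS h).2.1 rfl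
    · exact h.2.1.ne rfl
  have hlift : ∀ y ∈ C, SimplicialIn G (C ∪ B) y →
      ∃ y, SimplicialIn G S y ∧ y ≠ x ∧ ¬ G.Adj x y := by
    intro y hy hsimp
    refine ⟨y, ⟨(hCS hy).1, hsimp.2.subset ?_⟩, (hCS hy).2⟩
    rintro v ⟨hv, hyv⟩
    refine ⟨?_, hyv⟩
    by_cases hxv : G.Adj x v
    · exact Or.inr ⟨hv, hxv, y, hy, hyv.symm⟩
    · refine Or.inl (hCmem y hy v hv ?_ hxv hyv)
      rintro rfl
      exact (hCS hy).2.2 hyv.symm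
  by_cases hBu : ∃ b ∈ B, ∃ v ∈ C ∪ B, v ≠ b ∧ ¬ G.Adj b v
  · obtain ⟨b, hb, v, hv, hvb, hbv⟩ := hBu
    obtain ⟨y, hy, hyb, hby⟩ := ih _ hlt (Or.inr hb) hv hvb hbv
    refine hlift y (hy.1.resolve_right fun hyB => hby (hB hb hyB hyb.symm)) hy
  push Not at hBu
  by_cases hCu : ∃ c ∈ C, ∃ v ∈ C ∪ B, v ≠ c ∧ ¬ G.Adj c v
  · obtain ⟨c, hc, v, hv, hvc, hcv⟩ := hCu
    obtain ⟨y, hy, hyc, hcy⟩ := ih _ hlt (Or.inl hc) hv hvc hcv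
    exact hlift y (hy.1.resolve_right fun hyB =>
      hcy (hBu y hyB c (Or.inl hc) hyc.symm).symm) hy
  push Not at hCu
  refine hlift z hzC ⟨Or.inl hzC, ?_⟩
  rintro a ⟨ha | ha, -⟩ b ⟨hb, -⟩ hab
  · exact hCu a ha b hb hab.symm
  · exact hBu a ha b hb hab.symm

lemma exists_simplicialIn (hG : ChordalG G) {S : Set α} (hS : S.Nonempty) :
    ∃ y, SimplicialIn G S y := by
  by_cases h : ∃ x ∈ S, ∃ z ∈ S, z ≠ x ∧ ¬ G.Adj x z
  · obtain ⟨x, hx, z, hz, hzx, hxz⟩ := h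
    obtain ⟨y, hy, -⟩ := hG.exists_simplicialIn_not_adj S hx hz hzx hxz
    exact ⟨y, hy⟩
  · push Not at h
    obtain ⟨y, hy⟩ := hS
    exact ⟨y, hy, fun a ha b hb hab => h a ha.1 b hb.1 hab.symm⟩

end ChordalG

namespace SimpleGraph

variable {ι : Type}

/-- The graph obtained from `T` by attaching a new vertex `none` to the vertex `t`. -/
def addLeaf (T : SimpleGraph ι) (t : ι) : SimpleGraph (Option ι) :=
  T.map Function.Embedding.some ⊔ edge none (some t)

lemma addLeaf_adj_some (T : SimpleGraph ι) (t : ι) {a b : ι} (h : T.Adj a b) :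
    (T.addLeaf t).Adj (some a) (some b) :=
  Or.inl ((map_adj_apply (f := Function.Embedding.some)).2 h)

lemma addLeaf_adj_none (T : SimpleGraph ι) (t : ι) : (T.addLeaf t).Adj (some t) none :=
  Or.inr (by simp [edge_adj])

lemma connected_induce_addLeaf_some {T : SimpleGraph ι} (t : ι) {S : Set ι}
    (hS : (T.induce S).Connected) : ((T.addLeaf t).induce (some '' S)).Connected := by
  refine hS.map (⟨fun s => ⟨some s, s, s.2, rfl⟩, fun h => T.addLeaf_adj_some t h⟩ :
    T.induce S →g (T.addLeaf t).induce (some '' S)) ?_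
  rintro ⟨-, s, hs, rfl⟩
  exact ⟨⟨s, hs⟩, rfl⟩

lemma connected_induce_addLeaf_insert_none {T : SimpleGraph ι} {t : ι} {S : Set ι} (ht : t ∈ S)
    (hS : (T.induce S).Connected) :
    ((T.addLeaf t).induce (some '' S ∪ {none})).Connected :=
  connected_induce_union (connected_induce_addLeaf_some t hS).preconnected
    Preconnected.of_subsingleton (mem_image_of_mem _ ht) rfl (T.addLeaf_adj_none t)

lemma IsTree.addLeaf [Finite ι] {T : SimpleGraph ι} (hT : T.IsTree) (t : ι) :
    (T.addLeaf t).IsTree := by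
  rw [isTree_iff_connected_and_card] at hT ⊢
  constructor
  · have h := connected_induce_addLeaf_insert_none (mem_univ t)
      ((induceUnivIso T).connected_iff.2 hT.1)
    rw [show some '' univ ∪ {none} = (univ : Set (Option ι)) by
      ext (_ | a) <;> simp] at h
    exact (induceUnivIso _).connected_iff.1 h
  · have hedge : (T.addLeaf t).edgeSet =
        insert s(none, some t) (Function.Embedding.some.sym2Map '' T.edgeSet) := by
      rw [SimpleGraph.addLeaf, edgeSet_sup, edgeSet_map, union_comm, edge,
        edgeSet_fromEdgeSet]
      ext e
      simp only [mem_union, mem_sdiff, mem_singleton_iff, mem_insert_iff]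
      grind [Sym2.mem_diagSet, Sym2.mk_isDiag_iff]
    rw [hedge, Nat.card_coe_set_eq, ncard_insert_of_notMem, ncard_image_of_injective _
      (Function.Embedding.injective _), ← Nat.card_coe_set_eq, hT.2, Finite.card_option]
    rintro ⟨e, -, he⟩
    induction e with
    | _ a b => simp at he

end SimpleGraph

section SimplicialIn

variable {α : Type} {G : SimpleGraph α} {S : Set α}

/-- A clique containing `v` lies in the closed neighborhood of `v`. -/
lemma subset_closedNbhd_of_isClique {v : α} {K : Set α} (hKS : K ⊆ S)
    (hK : G.IsClique K) (hvK : v ∈ K) : K ⊆ insert v {u | u ∈ S ∧ G.Adj v u} := by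
  intro u hu
  by_cases huv : u = v
  · exact Or.inl huv
  · exact Or.inr ⟨hKS hu, hK hvK hu (Ne.symm huv)⟩

lemma SimplicialIn.isClique_insert {v : α} (hv : SimplicialIn G S v) :
    G.IsClique (insert v {u | u ∈ S ∧ G.Adj v u}) :=
  hv.2.insert fun _ hb _ => hb.2

lemma SimplicialIn.maximal_insert {v : α} (hv : SimplicialIn G S v) :
    Maximal (fun K => K ⊆ S ∧ G.IsClique K) (insert v {u | u ∈ S ∧ G.Adj v u}) :=
  ⟨⟨insert_subset hv.1 fun _ hu => hu.1, hv.isClique_insert⟩, fun _ hK hle =>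
    subset_closedNbhd_of_isClique hK.1 hK.2 (hle (mem_insert _ _))⟩

/-- A maximal clique of `S \ {v}` not contained in the neighborhood of `v` stays maximal in `S`. -/
lemma maximal_isClique_of_sdiff_singleton {v : α} {K : Set α}
    (hK : Maximal (fun K => K ⊆ S \ {v} ∧ G.IsClique K) K)
    (hne : ¬ K ⊆ {u | u ∈ S ∧ G.Adj v u}) : Maximal (fun K => K ⊆ S ∧ G.IsClique K) K := by
  refine ⟨⟨hK.prop.1.trans sdiff_subset, hK.prop.2⟩, fun L hL hKL => ?_⟩
  refine hK.le_of_ge ⟨subset_sdiff_singleton hL.1 fun hvL => hne fun u hu => ?_, hL.2⟩ hKL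
  exact (subset_closedNbhd_of_isClique hL.1 hL.2 hvL (hKL hu)).resolve_left
    (hK.prop.1 hu).2

end SimplicialIn

/-- `(T, χ)` is a clique tree of the subgraph of `G` induced by `S`: a tree decomposition whose
bags are the maximal cliques, each appearing exactly once. -/
structure IsCliqueTree {α ι : Type} (G : SimpleGraph α) (S : Set α) (T : SimpleGraph ι)
    (χ : ι → Set α) : Prop where
  finite : Finite ι
  isTree : T.IsTree
  maximal : ∀ t, Maximal (fun K => K ⊆ S ∧ G.IsClique K) (χ t)
  cover : ∀ K ⊆ S, G.IsClique K → ∃ t, K ⊆ χ t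
  subtree : ∀ v ∈ S, (T.induce {t | v ∈ χ t}).Connected
  injective : Function.Injective χ

namespace IsCliqueTree

variable {α ι : Type} {G : SimpleGraph α} {S : Set α} {T : SimpleGraph ι} {χ : ι → Set α}

lemma empty (G : SimpleGraph α) :
    IsCliqueTree G ∅ (⊥ : SimpleGraph Unit) (fun _ => (∅ : Set α)) where
  finite := inferInstance
  isTree := .of_subsingleton
  maximal _ := ⟨by simp, fun K hK _ => hK.1⟩
  cover K hK _ := ⟨(), hK⟩
  subtree v hv := hv.elim
  injective := Function.injective_of_subsingleton _

lemma isTD (h : IsCliqueTree G univ T χ) : IsTD G T χ where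
  finite := h.finite
  isTree := h.isTree
  memBag v := by
    obtain ⟨t, ht⟩ := h.cover {v} (subset_univ _) (by simp)
    exact ⟨t, ht rfl⟩
  edgeBag u v huv := by
    obtain ⟨t, ht⟩ := h.cover {u, v} (subset_univ _)
      (by rw [SimpleGraph.isClique_pair]; exact fun _ => huv)
    exact ⟨t, ht (by simp), ht (by simp)⟩
  subtree v := h.subtree v trivial

/-- A clique tree of `S \ {v}`, with `v` simplicial in `S`, one of whose bags is the neighborhood of
`v`, becomes a clique tree of `S` on adding `v` to that bag. -/
lemma update_insert [DecidableEq ι] {v : α} (hv : SimplicialIn G S v)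
    (h : IsCliqueTree G (S \ {v}) T χ) {t : ι} (ht : χ t = {u | u ∈ S ∧ G.Adj v u}) :
    IsCliqueTree G S T (Function.update χ t (insert v (χ t))) := by
  have hvχ : ∀ s, v ∉ χ s := fun s hs => ((h.maximal s).prop.1 hs).2 rfl
  have hle : ∀ s, χ s ⊆ Function.update χ t (insert v (χ t)) s := by
    intro s
    rcases eq_or_ne s t with rfl | hst
    · simp
    · simp [hst]
  refine ⟨h.finite, h.isTree, fun s => ?_, fun K hKS hK => ?_, fun u hu => ?_, ?_⟩
  · rcases eq_or_ne s t with rfl | hst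
    · rw [Function.update_self, ht]
      exact hv.maximal_insert
    · rw [Function.update_of_ne hst]
      refine maximal_isClique_of_sdiff_singleton (h.maximal s) fun hsub => hst (h.injective ?_)
      exact (h.maximal s).eq_of_subset (h.maximal t).prop (ht ▸ hsub)
  · by_cases hvK : v ∈ K
    · refine ⟨t, ?_⟩
      rw [Function.update_self, ht]
      exact subset_closedNbhd_of_isClique hKS hK hvK
    · obtain ⟨s, hs⟩ := h.cover K (subset_sdiff_singleton hKS hvK) hK
      exact ⟨s, hs.trans (hle s)⟩
  · by_cases huv : u = v
    · subst huv
      rw [show {s | u ∈ Function.update χ t (insert u (χ t)) s} = {t} by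
        ext s
        rcases eq_or_ne s t with rfl | hst
        · simp
        · simp [hst, hvχ]]
      exact SimpleGraph.connected_top.mono (by simp)
    · rw [show {s | u ∈ Function.update χ t (insert v (χ t)) s} = {s | u ∈ χ s} by
        ext s
        rcases eq_or_ne s t with rfl | hst
        · simp [huv]
        · simp [hst]]
      exact h.subtree u ⟨hu, huv⟩
  · intro a b hab
    by_contra hne
    rcases eq_or_ne a t with rfl | hat
    · rw [Function.update_self, Function.update_of_ne (Ne.symm hne)] at hab
      exact hvχ b (hab ▸ mem_insert _ _)
    · rcases eq_or_ne b t with rfl | hbt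
      · rw [Function.update_self, Function.update_of_ne hne] at hab
        exact hvχ a (hab ▸ mem_insert _ _)
      · rw [Function.update_of_ne hat, Function.update_of_ne hbt] at hab
        exact hne (h.injective hab)

/-- A clique tree of `S \ {v}`, with `v` simplicial in `S`, none of whose bags is the neighborhood
of `v`, becomes a clique tree of `S` on attaching a leaf whose bag is the closed neighborhood. -/
lemma addLeaf {v : α} (hv : SimplicialIn G S v) (h : IsCliqueTree G (S \ {v}) T χ)
    (hne : ∀ t, χ t ≠ {u | u ∈ S ∧ G.Adj v u}) {t : ι} (ht : {u | u ∈ S ∧ G.Adj v u} ⊆ χ t) :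
    IsCliqueTree G S (T.addLeaf t) (fun o => o.elim (insert v {u | u ∈ S ∧ G.Adj v u}) χ) := by
  have hvχ : ∀ s, v ∉ χ s := fun s hs => ((h.maximal s).prop.1 hs).2 rfl
  have := h.finite
  refine ⟨inferInstance, h.isTree.addLeaf t, ?_, fun K hKS hK => ?_, fun u hu => ?_, ?_⟩
  · rintro (_ | s)
    · exact hv.maximal_insert
    · refine maximal_isClique_of_sdiff_singleton (h.maximal s) fun hsub => hne s (hsub.antisymm ?_)
      exact ht.trans ((h.maximal s).eq_of_subset (h.maximal t).prop (hsub.trans ht)).ge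
  · by_cases hvK : v ∈ K
    · exact ⟨none, subset_closedNbhd_of_isClique hKS hK hvK⟩
    · obtain ⟨s, hs⟩ := h.cover K (subset_sdiff_singleton hKS hvK) hK
      exact ⟨some s, hs⟩
  · rcases eq_or_ne u v with rfl | huv
    · rw [show {o : Option ι | u ∈ o.elim (insert u {w | w ∈ S ∧ G.Adj u w}) χ} = {none} by
        ext (_ | s) <;> simp [hvχ]]
      exact SimpleGraph.connected_top.mono (by simp)
    by_cases hvu : G.Adj v u
    · rw [show {o : Option ι | u ∈ o.elim (insert v {w | w ∈ S ∧ G.Adj v w}) χ} =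
          some '' {s | u ∈ χ s} ∪ {none} by
        ext (_ | s) <;> simp [hu, hvu]]
      exact SimpleGraph.connected_induce_addLeaf_insert_none (ht ⟨hu, hvu⟩)
        (h.subtree u ⟨hu, huv⟩)
    · rw [show {o : Option ι | u ∈ o.elim (insert v {w | w ∈ S ∧ G.Adj v w}) χ} =
          some '' {s | u ∈ χ s} by
        ext (_ | s) <;> simp [hvu, huv]]
      exact SimpleGraph.connected_induce_addLeaf_some t (h.subtree u ⟨hu, huv⟩)
  · rintro (_ | a) (_ | b) hab
    · rfl
    · have hab : insert v _ = χ b := hab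
      exact absurd (hab ▸ mem_insert _ _) (hvχ b)
    · have hab : χ a = insert v _ := hab
      exact absurd (hab ▸ mem_insert _ _) (hvχ a)
    · exact congrArg some (h.injective hab)

end IsCliqueTree

/-- Every induced subgraph of a finite chordal graph has a clique tree. -/
lemma ChordalG.exists_isCliqueTree {α : Type} [Finite α] {G : SimpleGraph α} (hG : ChordalG G)
    (S : Set α) : ∃ (ι : Type) (T : SimpleGraph ι) (χ : ι → Set α), IsCliqueTree G S T χ := by
  classical
  induction S using WellFoundedLT.induction with
  | ind S ih =>
  rcases S.eq_empty_or_nonempty with rfl | hS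
  · exact ⟨_, _, _, .empty G⟩
  obtain ⟨v, hv⟩ := hG.exists_simplicialIn hS
  obtain ⟨ι, T, χ, h⟩ := ih (S \ {v}) (sdiff_singleton_ssubset.2 hv.1)
  by_cases hN : ∃ t, χ t = {u | u ∈ S ∧ G.Adj v u}
  · obtain ⟨t, ht⟩ := hN
    exact ⟨_, _, _, h.update_insert hv ht⟩
  · push Not at hN
    obtain ⟨t, ht⟩ := h.cover _ (fun u hu => ⟨hu.1, hu.2.ne'⟩) hv.2
    exact ⟨_, _, _, h.addLeaf hv hN ht⟩

/-- every tree decomposition can be refined to a structured one (all bags are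
potential maximal cliques), each new bag contained in an old bag. -/
theorem stmt_2 {V ι : Type} [Fintype V] (G : SimpleGraph V)
    (T : SimpleGraph ι) (χ : ι → Set V) (h : IsTD G T χ) :
    ∃ (ι' : Type) (T' : SimpleGraph ι') (χ' : ι' → Set V),
      StructuredTD G T' χ' ∧ ∀ v' : ι', ∃ v : ι, χ' v' ⊆ χ v := by
  obtain ⟨G', hG', hle⟩ := exists_isMinChordalCompletion_le h.le_bagGraph h.chordalG_bagGraph
  obtain ⟨ι', T', χ', hT'⟩ := hG'.2.1.exists_isCliqueTree univ
  have hTD := hT'.isTD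
  refine ⟨ι', T', χ', ⟨{ hTD with edgeBag := fun u v huv => hTD.edgeBag (hG'.1 huv) },
    fun t => ⟨G', hG', (hT'.maximal t).prop.2, fun Ω hΩ hsub =>
      ((hT'.maximal t).eq_of_subset ⟨subset_univ _, hΩ⟩ hsub).symm⟩⟩, fun t => ?_⟩
  exact h.exists_bag_of_isClique_bagGraph ((hT'.maximal t).prop.2.mono hle)
end

section
/- Let G be a finite theta-free graph that does not admit a clique cutset, and let (T,χ) be a tight tree decomposition of G such that χ(t) ∖ χ(t') ≠ ∅ and χ(t') ∖ χ(t) ≠ ∅ for every edge tt' of T. Then for every edge t1t2 of T, the graph G_{t1→t2} ∖ χ(t1) is connected and N(G_{t1→t2} ∖ χ(t1)) = χ(t1) ∩ χ(t2). Moreover, if t0 is a node of T and t1, t2 are two distinct neighbors of t0 in T, then χ(t0) ∩ χ(t1) ≠ χ(t0) ∩ χ(t2). -/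
open Set

section Connectivity

variable {α : Type} {G : SimpleGraph α} {A D : Set α} {u v x y : α}

/-- A preconnected set that meets both `P` and its complement has an edge leaving `P`. -/
lemma exists_adj_leaving (hA : (G.induce A).Preconnected) (hu : u ∈ A) (hv : v ∈ A)
    (P : Set α) (hPu : u ∈ P) (hPv : v ∉ P) :
    ∃ a ∈ A, ∃ b ∈ A, G.Adj a b ∧ a ∈ P ∧ b ∉ P := by
  obtain ⟨w⟩ := hA ⟨u, hu⟩ ⟨v, hv⟩
  obtain ⟨d, -, h1, h2⟩ := w.exists_boundary_dart (Subtype.val ⁻¹' P) hPu hPv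
  exact ⟨d.fst, d.fst.2, d.snd, d.snd.2, d.adj, h1, h2⟩

/-- Every vertex of `A` lies in a connected subset of `A` that is closed under adjacency
within `A`. -/
lemma exists_connSet_closed (hu : u ∈ A) :
    ∃ E ⊆ A, u ∈ E ∧ ConnSet G E ∧ ∀ a ∈ E, ∀ b ∈ A, G.Adj a b → b ∈ E := by
  let c := (G.induce A).connectedComponentMk ⟨u, hu⟩
  refine ⟨Subtype.val '' c.supp, ?_, ⟨⟨u, hu⟩, rfl, rfl⟩, ?_, ?_⟩
  · rintro _ ⟨a, -, rfl⟩
    exact a.2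
  · let f : (G.induce A).induce c.supp →g G.induce (Subtype.val '' c.supp) :=
      ⟨fun a => ⟨a.1.1, a.1, a.2, rfl⟩, fun h => h⟩
    refine SimpleGraph.Connected.map f ?_ c.connected_toSimpleGraph
    rintro ⟨_, a, ha, rfl⟩
    exact ⟨⟨a, ha⟩, rfl⟩
  · rintro _ ⟨a, ha, rfl⟩ b hb hab
    refine ⟨⟨b, hb⟩, ?_, rfl⟩
    have : (G.induce A).Adj a ⟨b, hb⟩ := hab
    exact (SimpleGraph.ConnectedComponent.mem_supp_congr_adj c this).1 ha

/-- A connected set attached to two distinct non-adjacent vertices contains the interior of an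
induced path between them. -/
lemma exists_inducedPath_through (hD : ConnSet G D) (hxy : x ≠ y) (hadj : ¬ G.Adj x y)
    (hx : ∃ a ∈ D, G.Adj x a) (hy : ∃ a ∈ D, G.Adj y a) :
    ∃ (n : ℕ) (f : Fin n → α), 3 ≤ n ∧ IsPathFromTo G n f x y ∧ pathInterior n f ⊆ D := by
  obtain ⟨a, ha, hxa⟩ := hx
  obtain ⟨b, hb, hyb⟩ := hy
  let B : Set α := D ∪ {x, y}
  have hDB : D ⊆ B := subset_union_left
  let x' : B := ⟨x, by simp [B]⟩
  let y' : B := ⟨y, by simp [B]⟩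
  have hab : (G.induce B).Reachable ⟨a, hDB ha⟩ ⟨b, hDB hb⟩ :=
    (hD.preconnected ⟨a, ha⟩ ⟨b, hb⟩).map (SimpleGraph.induceHomOfLE G hDB).toHom
  have hxa' : (G.induce B).Adj x' ⟨a, hDB ha⟩ := hxa
  have hby' : (G.induce B).Adj ⟨b, hDB hb⟩ y' := hyb.symm
  obtain ⟨p, hp⟩ := ((hxa'.reachable.trans hab).trans hby'.reachable).exists_walk_length_eq_dist
  have hpath := p.isPath_of_length_eq_dist hp
  have hinj : ∀ i j : ℕ, i ≤ p.length → j ≤ p.length →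
      (p.getVert i).1 = (p.getVert j).1 → i = j :=
    fun i j hi hj h => hpath.getVert_injOn hi hj (Subtype.ext h)
  have hshort : ∀ i j : ℕ, j ≤ p.length → i < j → (G.induce B).Adj (p.getVert i) (p.getVert j) →
      j = i + 1 := by
    intro i j hj hij h
    have := SimpleGraph.dist_le ((p.take i).append (SimpleGraph.Walk.cons h (p.drop j)))
    simp only [SimpleGraph.Walk.length_append, SimpleGraph.Walk.length_cons,
      SimpleGraph.Walk.take_length, SimpleGraph.Walk.drop_length] at this
    omega
  have hlen : 2 ≤ p.length := by
    by_contra! hlt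
    interval_cases h : p.length
    · exact hxy (congrArg Subtype.val (SimpleGraph.Walk.eq_of_length_eq_zero h))
    · have : (G.induce B).Adj x' y' := SimpleGraph.Walk.adj_of_length_eq_one h
      exact hadj this
  refine ⟨p.length + 1, fun i => (p.getVert i).1, by omega,
    ⟨⟨?_, ?_⟩, by omega, by simp [x'], by simp [y']⟩, ?_⟩
  · intro i j h
    exact Fin.ext (hinj i j (by omega) (by omega) h)
  · intro i j
    constructor
    · intro h
      rcases lt_trichotomy i.val j.val with hij | hij | hij
      · exact Or.inr (hshort i j (by omega) hij h)
      · simp [hij] at h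
      · exact Or.inl (hshort j i (by omega) hij h.symm)
    · rintro (h | h)
      · have : (G.induce B).Adj _ _ := p.adj_getVert_succ (i := j) (by omega)
        simp only [h]
        exact this.symm
      · have : (G.induce B).Adj _ _ := p.adj_getVert_succ (i := i) (by omega)
        simp only [h]
        exact this
  · rintro _ ⟨i, h0, hn, rfl⟩
    rcases (p.getVert i).2 with h | h | h
    · exact h
    · have := hinj i 0 (by omega) (by omega) (by simpa [x'] using h)
      omega
    · have := hinj i p.length (by omega) le_rfl (by simpa [y'] using h)
      omega

/-- Three pairwise disjoint and anticomplete connected sets attached to two distinct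
non-adjacent vertices yield a theta. -/
lemma hasTheta_of_connSets (K : Fin 3 → Set α) (hK : ∀ i, ConnSet G (K i)) (hxy : x ≠ y)
    (hadj : ¬ G.Adj x y) (hx : ∀ i, x ∈ setNbhd G (K i)) (hy : ∀ i, y ∈ setNbhd G (K i))
    (hsep : ∀ i j, i ≠ j → Disjoint (K i) (K j) ∧ Anticomplete G (K i) (K j)) :
    HasTheta G := by
  choose n f hn hf hint using fun i =>
    exists_inducedPath_through (hK i) hxy hadj (hx i).2 (hy i).2
  refine ⟨x, y, n, f, hxy, hadj, hn, hf, fun i j hij u v hu hu' hv hv' => ?_⟩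
  have h1 : f i u ∈ K i := hint i ⟨u, hu, hu', rfl⟩
  have h2 : f j v ∈ K j := hint j ⟨v, hv, hv', rfl⟩
  exact ⟨(hsep i j hij).1.ne_of_mem h1 h2, (hsep i j hij).2 _ h1 _ h2⟩

/-- In a graph without clique cutset, a set with a vertex outside its closed neighborhood has
two distinct non-adjacent vertices in its neighborhood. -/
lemma exists_nonadj_of_not_hasCliqueCutset (hcc : ¬ HasCliqueCutset G) (hu : u ∈ A)
    (hv : v ∉ A) (hv' : v ∉ setNbhd G A) :
    ∃ x ∈ setNbhd G A, ∃ y ∈ setNbhd G A, x ≠ y ∧ ¬ G.Adj x y := by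
  by_contra! hclique
  refine hcc ⟨setNbhd G A, fun x hx y hy hne => hclique x hx y hy hne, fun hconn => ?_⟩
  obtain ⟨a, -, b, hb, hab, ha, hbA⟩ := exists_adj_leaving hconn
    ⟨mem_univ u, fun h => h.1 hu⟩ ⟨mem_univ v, hv'⟩ A hu hv
  exact hb.2 ⟨hbA, a, ha, hab.symm⟩

end Connectivity

section TreeDecomposition

variable {α ι : Type} {G : SimpleGraph α} {T : SimpleGraph ι} {χ : ι → Set α}
  {s s' t t' : ι} {a b : α}

lemma right_mem_branchSet : t' ∈ branchSet T t t' := fun w => w.start_mem_support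

lemma left_notMem_branchSet (h : T.Adj t t') : t ∉ branchSet T t t' := fun ht =>
  h.ne' (by simpa using ht SimpleGraph.Walk.nil)

lemma eq_of_adj_of_mem_branchSet (h : T.Adj t t') (hs : s ∈ branchSet T t t')
    (hst : T.Adj s t) : s = t' := by
  have := hs hst.toWalk
  simp only [SimpleGraph.Walk.support_cons, SimpleGraph.Walk.support_nil, List.mem_cons,
    List.not_mem_nil, or_false] at this
  exact (this.resolve_right h.ne').symm

lemma mem_branchSet_of_adj (hT : T.IsAcyclic) (h : T.Adj t t') (hs : s ∈ branchSet T t t')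
    (hss : T.Adj s s') (hne : s' ≠ t) : s' ∈ branchSet T t t' := by
  intro w
  have hw := hs (SimpleGraph.Walk.cons hss w)
  rw [SimpleGraph.Walk.support_cons, List.mem_cons] at hw
  rcases hw with rfl | hw
  · have hb := SimpleGraph.isBridge_iff_forall_walk_mem_edges.1
      (SimpleGraph.isAcyclic_iff_forall_adj_isBridge.1 hT h.symm)
    have := hb (SimpleGraph.Walk.cons hss w)
    rw [SimpleGraph.Walk.edges_cons, List.mem_cons] at this
    rcases this with he | he
    · simp only [Sym2.eq_iff, true_and] at he
      rcases he with he | he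
      · exact absurd he.symm hne
      · exact absurd he.2 h.ne
    · exact w.fst_mem_support_of_mem_edges he
  · exact hw

/-- The only edge of a tree leaving `branchSet T t t'` is `t't`. -/
lemma eq_and_eq_of_adj_leaving_branchSet (hT : T.IsAcyclic) (h : T.Adj t t')
    (hs : s ∈ branchSet T t t') (hss : T.Adj s s') (hs' : s' ∉ branchSet T t t') :
    s = t' ∧ s' = t := by
  have hs't : s' = t := by
    by_contra hne
    exact hs' (mem_branchSet_of_adj hT h hs hss hne)
  subst hs't
  exact ⟨eq_of_adj_of_mem_branchSet h hs hss, rfl⟩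

lemma disjoint_branchSet (hT : T.IsTree) (h : T.Adj t t') :
    Disjoint (branchSet T t t') (branchSet T t' t) := by
  rw [Set.disjoint_left]
  intro s h1 h2
  obtain ⟨w⟩ := hT.1.preconnected s t
  obtain ⟨d, -, hd1, hd2⟩ := w.exists_boundary_dart (branchSet T t t' ∩ branchSet T t' t)
    ⟨h1, h2⟩ fun ht => left_notMem_branchSet h ht.1
  rw [Set.mem_inter_iff, not_and_or] at hd2
  rcases hd2 with hd2 | hd2
  · have := (eq_and_eq_of_adj_leaving_branchSet hT.2 h hd1.1 d.adj hd2).1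
    exact left_notMem_branchSet h.symm (this ▸ hd1.2)
  · have := (eq_and_eq_of_adj_leaving_branchSet hT.2 h.symm hd1.2 d.adj hd2).1
    exact left_notMem_branchSet h (this ▸ hd1.1)

lemma mem_sideSet : a ∈ sideSet T χ t t' ↔ ∃ s ∈ branchSet T t t', a ∈ χ s := by
  simp [sideSet]

/-- A vertex with bags on both sides of a tree edge lies in the adhesion of that edge. -/
lemma IsTD.mem_adhesion (hTD : IsTD G T χ) (h : T.Adj t t') (hs : s ∈ branchSet T t t')
    (hs' : s' ∉ branchSet T t t') (has : a ∈ χ s) (has' : a ∈ χ s') : a ∈ χ t ∩ χ t' := by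
  obtain ⟨r, hr, r', hr', hrr, hrb, hrb'⟩ := exists_adj_leaving (hTD.subtree a).preconnected
    (u := s) (v := s') has has' (branchSet T t t') hs hs'
  obtain ⟨rfl, rfl⟩ := eq_and_eq_of_adj_leaving_branchSet hTD.isTree.2 h hrb hrr hrb'
  exact ⟨hr', hr⟩

lemma IsTD.mem_sideSet_of_adj (hTD : IsTD G T χ) (h : T.Adj t t')
    (ha : a ∈ sideSet T χ t t' \ χ t) (hab : G.Adj a b) : b ∈ sideSet T χ t t' := by
  obtain ⟨s, hs, has⟩ := mem_sideSet.1 ha.1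
  obtain ⟨r, har, hbr⟩ := hTD.edgeBag hab
  refine mem_sideSet.2 ⟨r, ?_, hbr⟩
  by_contra hr
  exact ha.2 (hTD.mem_adhesion h hs hr has har).1

lemma IsTD.mem_adhesion_of_mem_sideSet (hTD : IsTD G T χ) (h : T.Adj t t')
    (ha : a ∈ sideSet T χ t t') (hat : a ∈ χ t) : a ∈ χ t ∩ χ t' := by
  obtain ⟨s, hs, has⟩ := mem_sideSet.1 ha
  exact hTD.mem_adhesion h hs (left_notMem_branchSet h) has hat

lemma IsTD.disjoint_sideSet (hTD : IsTD G T χ) (h : T.Adj t t') :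
    Disjoint (sideSet T χ t t') (sideSet T χ t' t \ χ t') := by
  rw [Set.disjoint_left]
  rintro a ha ⟨ha', hat'⟩
  obtain ⟨s, hs, has⟩ := mem_sideSet.1 ha
  obtain ⟨s', hs', has'⟩ := mem_sideSet.1 ha'
  exact hat' (hTD.mem_adhesion h hs
    ((disjoint_branchSet hTD.isTree h).notMem_of_mem_right hs') has has').2

lemma IsTD.anticomplete_sides (hTD : IsTD G T χ) (h : T.Adj t t') :
    Anticomplete G (sideSet T χ t t' \ χ t) (sideSet T χ t' t \ χ t') := fun _ ha _ hb hab =>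
  (hTD.disjoint_sideSet h).notMem_of_mem_right hb (hTD.mem_sideSet_of_adj h ha hab)

/-- The side of a neighbor `t'` of `t` lies in the `t`-side of any other neighbor `s`. -/
lemma IsTD.sideSet_diff_subset (hTD : IsTD G T χ) (h : T.Adj t t') (hs : T.Adj t s)
    (hne : s ≠ t') : sideSet T χ t t' \ χ t ⊆ sideSet T χ s t \ χ s := by
  have hsb : s ∉ branchSet T t t' := fun hmem =>
    hne (eq_of_adj_of_mem_branchSet h hmem hs.symm)
  rintro a ⟨ha, hat⟩
  obtain ⟨r, hr, har⟩ := mem_sideSet.1 ha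
  refine ⟨mem_sideSet.2 ⟨r, fun w => ?_, har⟩,
    fun has => hat (hTD.mem_adhesion h hr hsb har has).1⟩
  obtain ⟨d, hd, hd1, hd2⟩ := w.exists_boundary_dart _ hr hsb
  rw [← (eq_and_eq_of_adj_leaving_branchSet hTD.isTree.2 h hd1 d.adj hd2).2]
  exact w.dart_snd_mem_support_of_mem_darts hd

/-- In a theta-free graph without clique cutset, if both sides of an edge `tt'` contain connected
sets whose neighborhood is the adhesion, then each of them is the whole side. -/
lemma IsTD.eq_side_of_setNbhd_eq (hTD : IsTD G T χ) (hfree : ¬ HasTheta G)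
    (hcc : ¬ HasCliqueCutset G) (h : T.Adj t t') {D D' : Set α}
    (hD : ConnSet G D) (hDS : D ⊆ sideSet T χ t t' \ χ t) (hN : setNbhd G D = χ t ∩ χ t')
    (hD' : ConnSet G D') (hDS' : D' ⊆ sideSet T χ t' t \ χ t')
    (hN' : setNbhd G D' = χ t ∩ χ t') : D = sideSet T χ t t' \ χ t := by
  by_contra hne
  obtain ⟨v, hvS, hvD⟩ := Set.exists_of_ssubset (hDS.ssubset_of_ne hne)
  obtain ⟨E, hES, hvE, hE, hEcl⟩ := exists_connSet_closed (G := G)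
    (A := (sideSet T χ t t' \ χ t) \ D) ⟨hvS, hvD⟩
  have hDE : Disjoint D E := Set.disjoint_left.2 fun a ha haE => (hES haE).2 ha
  have hantiDE : Anticomplete G D E := fun a ha b hb hab => by
    have : b ∈ χ t ∩ χ t' := hN ▸ ⟨(hES hb).2, a, ha, hab.symm⟩
    exact (hES hb).1.2 this.1
  have hEN : setNbhd G E ⊆ χ t ∩ χ t' := by
    rintro x ⟨hxE, a, ha, hxa⟩
    have hx := hTD.mem_sideSet_of_adj h (hES ha).1 hxa.symm
    by_cases hxt : x ∈ χ t
    · exact hTD.mem_adhesion_of_mem_sideSet h hx hxt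
    · exact absurd (hEcl a ha x ⟨⟨hx, hxt⟩, fun hxD => hantiDE x hxD a ha hxa⟩ hxa.symm) hxE
  obtain ⟨⟨d, hd⟩⟩ := hD.nonempty
  obtain ⟨x, hx, y, hy, hxy, hadj⟩ := exists_nonadj_of_not_hasCliqueCutset hcc hvE
    (fun hdE => (hES hdE).2 hd) (fun hdN => (hDS hd).2 (hEN hdN).1)
  have hsym : ∀ {A B : Set α}, Disjoint A B ∧ Anticomplete G A B →
      Disjoint B A ∧ Anticomplete G B A :=
    fun hAB => ⟨hAB.1.symm, fun a ha b hb hab => hAB.2 b hb a ha hab.symm⟩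
  have hside : ∀ {A : Set α}, A ⊆ sideSet T χ t t' \ χ t → Disjoint A D' ∧ Anticomplete G A D' :=
    fun hA => ⟨(hTD.disjoint_sideSet h).mono (hA.trans Set.sdiff_subset) hDS',
      fun a ha b hb => hTD.anticomplete_sides h a (hA ha) b (hDS' hb)⟩
  have hsepDE := And.intro hDE hantiDE
  have hsepD := hside hDS
  have hsepE := hside (hES.trans Set.sdiff_subset)
  refine hfree (hasTheta_of_connSets ![D, E, D'] ?_ hxy hadj ?_ ?_ ?_)
  · intro i
    fin_cases i
    exacts [hD, hE, hD']
  · intro i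
    fin_cases i
    exacts [hN ▸ hEN hx, hx, hN' ▸ hEN hx]
  · intro i
    fin_cases i
    exacts [hN ▸ hEN hy, hy, hN' ▸ hEN hy]
  · intro i j hij
    fin_cases i <;> fin_cases j
    exacts [absurd rfl hij, hsepDE, hsepD, hsym hsepDE, absurd rfl hij, hsepE, hsym hsepD,
      hsym hsepE, absurd rfl hij]

end TreeDecomposition

/-- in a theta-free graph with no clique cutset, for any tight tree decomposition
with distinct bags along edges, each `G_{t1→t2} ∖ χ(t1)` is connected with neighborhood
`χ(t1) ∩ χ(t2)`, and adhesions at a common node are pairwise distinct. -/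
theorem stmt_3 {V ι : Type} [Fintype V] (G : SimpleGraph V)
    (hfree : ¬ HasTheta G) (hcc : ¬ HasCliqueCutset G)
    (T : SimpleGraph ι) (χ : ι → Set V) (hT : TightTD G T χ)
    (hdiff : ∀ ⦃t t' : ι⦄, T.Adj t t' → (χ t \ χ t').Nonempty ∧ (χ t' \ χ t).Nonempty) :
    (∀ ⦃t1 t2 : ι⦄, T.Adj t1 t2 →
      ConnSet G (sideSet T χ t1 t2 \ χ t1) ∧
      setNbhd G (sideSet T χ t1 t2 \ χ t1) = χ t1 ∩ χ t2) ∧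
    (∀ t0 t1 t2 : ι, T.Adj t0 t1 → T.Adj t0 t2 → t1 ≠ t2 →
      χ t0 ∩ χ t1 ≠ χ t0 ∩ χ t2) := by
  have hTD := hT.1
  have hside : ∀ ⦃t1 t2 : ι⦄, T.Adj t1 t2 →
      ConnSet G (sideSet T χ t1 t2 \ χ t1) ∧
      setNbhd G (sideSet T χ t1 t2 \ χ t1) = χ t1 ∩ χ t2 := by
    intro t1 t2 h
    obtain ⟨D, hD, hN⟩ := hT.2 h
    obtain ⟨D', hD', hN'⟩ := hT.2 h.symm
    rw [← hTD.eq_side_of_setNbhd_eq hfree hcc h hD.2.1 hD.1 hN hD'.2.1 hD'.1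
      (hN'.trans (Set.inter_comm _ _))]
    exact ⟨hD.2.1, hN⟩
  refine ⟨hside, fun t0 t1 t2 h1 h2 hne heq => ?_⟩
  obtain ⟨p, hp0, hp1⟩ := (hdiff h1).1
  obtain ⟨⟨d, hd⟩⟩ := (hside h2).1.nonempty
  obtain ⟨a, -, b, hb, hab, ha, hb'⟩ := exists_adj_leaving (hside h1.symm).1.preconnected
    (hTD.sideSet_diff_subset h2 h1 hne hd)
    ⟨mem_sideSet.2 ⟨t0, right_mem_branchSet, hp0⟩, hp1⟩
    (sideSet T χ t0 t2 \ χ t0) hd (fun hp => hp.2 hp0)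
  have hbN : b ∈ χ t0 ∩ χ t2 := (hside h2).2 ▸ ⟨hb', a, ha, hab.symm⟩
  rw [← heq] at hbN
  exact hb.2 hbN.2
end
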